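/- Let m ≥ 2 be an integer and let (v_t)_{t≥0} be defined by v_0 = 0 and v_{t+1} = 1/(∑_{r=0}^{m-1}(1-v_t)^r). Then for every integer t ≥ 1, v_{t+1}·(1-v_t)^{m-1} ≥ 1/(e·m²·t). -/

import Mathlib

theorem exp_chord (s : ℝ) (h0 : 0 ≤ s) (h1 : s ≤ 1) :
    Real.exp s ≤ 1 + (Real.exp 1 - 1) * s := by
  have h := convexOn_exp.2 (Set.mem_univ (0:ℝ)) (Set.mem_univ (1:ℝ))
    (sub_nonneg.2 h1) h0 (by ring)
  simp at h
  linarith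

theorem inv_aux (k : ℕ) (hk : 1 ≤ k) (v : ℕ → ℝ) (hv0 : v 0 = 0)
    (hvs : ∀ t : ℕ, v (t + 1) = 1 / ∑ r ∈ Finset.range (k + 1), (1 - v t) ^ r) (t : ℕ) :
    0 < 1 - v t ∧ 1 - v t ≤ 1 ∧
      1 / (1 - v t) ^ k ≤ 1 + (Real.exp 1 - 1) * k * t := by
  induction t with
  | zero => simp [hv0]
  | succ t ih =>
    obtain ⟨hx0, hx1, hu⟩ := ih
    have hv := hvs t
    generalize 1 - v t = x at *
    set A := ∑ r ∈ Finset.range k, x ^ r with hA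
    have e1 : ∑ r ∈ Finset.range (k + 1), x ^ r = A + x ^ k := Finset.sum_range_succ _ _
    have e2 : ∑ r ∈ Finset.range (k + 1), x ^ r = x * A + 1 := by
      rw [Finset.sum_range_succ', hA, Finset.mul_sum]
      simp [pow_succ, mul_comm]
    have hy : 0 < x ^ k := pow_pos hx0 k
    have hA1 : 1 ≤ A := by
      have := Finset.single_le_sum (f := fun r => x ^ r) (s := Finset.range k)
        (fun i _ => (pow_pos hx0 i).le) (Finset.mem_range.2 hk)
      simpa using this
    have hAk : k * x ^ k ≤ A := by
      have := Finset.card_nsmul_le_sum (Finset.range k) (fun r => x ^ r) (x ^ k)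
        (fun i hi => pow_le_pow_of_le_one hx0.le hx1 (Finset.mem_range.1 hi).le)
      simpa using this
    have hx' : 1 - v (t + 1) = x / (1 + x ^ k / A) := by
      rw [hv, e1]
      have h3 : A + x ^ k = x * A + 1 := by rw [← e1, e2]
      have : A + x ^ k ≠ 0 := by positivity
      have : A ≠ 0 := by positivity
      have : 1 + x ^ k / A = (A + x ^ k) / A := by field_simp
      rw [this]
      field_simp
      linarith
    have hd : 1 ≤ 1 + x ^ k / A := by
      have : 0 ≤ x ^ k / A := by positivity
      linarith
    rw [hx']
    refine ⟨by positivity, ?_, ?_⟩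
    · rw [div_le_one (by positivity)]; linarith
    · have hp : (1 + x ^ k / A) ^ k ≤ 1 + (Real.exp 1 - 1) * (k * x ^ k / A) := by
        calc (1 + x ^ k / A) ^ k ≤ (Real.exp (x ^ k / A)) ^ k := by
              apply pow_le_pow_left₀ (by positivity)
              linarith [Real.add_one_le_exp (x ^ k / A)]
          _ = Real.exp (k * x ^ k / A) := by rw [← Real.exp_nat_mul, mul_div_assoc]
          _ ≤ _ := exp_chord _ (by positivity) ((div_le_one (by positivity)).2 hAk)
      have he : 0 ≤ Real.exp 1 - 1 := by linarith [Real.add_one_le_exp (1:ℝ)]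
      calc 1 / (x / (1 + x ^ k / A)) ^ k = (1 + x ^ k / A) ^ k / x ^ k := by
            rw [div_pow, one_div_div]
        _ ≤ (1 + (Real.exp 1 - 1) * (k * x ^ k / A)) / x ^ k := by gcongr
        _ = 1 / x ^ k + (Real.exp 1 - 1) * k / A := by field_simp
        _ ≤ (1 + (Real.exp 1 - 1) * k * t) + (Real.exp 1 - 1) * k := by
            apply add_le_add hu
            exact div_le_self (by positivity) hA1
        _ = _ := by push_cast; ring

/-- Let `m ≥ 2` and let `(v_t)` be the value-iteration
(equivalently, strategy-iteration) sequence for `P(1,m)`: `v 0 = 0` and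
`v (t+1) = 1/∑_{r=0}^{m-1}(1 - v t)^r`. Then for every `t ≥ 1`,
`v_{t+1}·(1 - v_t)^{m-1} ≥ 1/(e·m²·t)`; i.e. the smallest behavior probability
of the strategy computed by strategy iteration at iteration `t+1` is at least
`1/(e·m²·t)`. -/
theorem stmt12 (m : ℕ) (hm : 2 ≤ m)
    (v : ℕ → ℝ) (hv0 : v 0 = 0)
    (hvs : ∀ t : ℕ, v (t + 1) = 1 / ∑ r ∈ Finset.range m, (1 - v t) ^ r)
    (t : ℕ) (ht : 1 ≤ t) :
    v (t + 1) * (1 - v t) ^ (m - 1) ≥ 1 / (Real.exp 1 * (m : ℝ) ^ 2 * (t : ℝ)) := by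
  obtain ⟨k, rfl⟩ : ∃ k, m = k + 1 := ⟨m - 1, by omega⟩
  obtain ⟨hx0, hx1, hu⟩ := inv_aux k (by omega) v hv0 hvs t
  rw [hvs t, Nat.add_sub_cancel]
  generalize 1 - v t = x at *
  have hy : 0 < x ^ k := pow_pos hx0 k
  have ht' : (1:ℝ) ≤ t := by exact_mod_cast ht
  have hS : ∑ r ∈ Finset.range (k + 1), x ^ r ≤ ((k + 1 : ℕ) : ℝ) := by
    have := Finset.sum_le_card_nsmul (Finset.range (k + 1)) (fun r => x ^ r) 1
      (fun i _ => pow_le_one₀ hx0.le hx1)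
    simpa using this
  have hS0 : 0 < ∑ r ∈ Finset.range (k + 1), x ^ r :=
    Finset.sum_pos (fun i _ => pow_pos hx0 i) (by simp)
  have he : 1 ≤ Real.exp 1 := by linarith [Real.add_one_le_exp (1:ℝ)]
  have hb : 1 / x ^ k ≤ Real.exp 1 * ((k + 1 : ℕ) : ℝ) * t := by
    refine hu.trans ?_
    push_cast
    have h1 : (1:ℝ) ≤ Real.exp 1 * t := one_le_mul_of_one_le_of_one_le he ht'
    have h2 : (0:ℝ) ≤ k * t := by positivity
    nlinarith
  have hfin : (∑ r ∈ Finset.range (k + 1), x ^ r) * (1 / x ^ k)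
      ≤ Real.exp 1 * ((k + 1 : ℕ) : ℝ) ^ 2 * t := by
    calc _ ≤ ((k + 1 : ℕ) : ℝ) * (Real.exp 1 * ((k + 1 : ℕ) : ℝ) * t) := by gcongr
      _ = _ := by ring
  have := one_div_le_one_div_of_le (by positivity) hfin
  refine this.trans (le_of_eq ?_)
  field_simp
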